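/- arXiv:1605.04537 — 2 statements merged into one kernel-verified Lean document; each statement's English description precedes it below -/
import Mathlib

section
/- Let M ≥ 1 and let f₁, f₂ be holomorphic functions on the open disc of radius 2 centered at 0 in ℂ with |f₁| ≤ M and |f₂| ≤ M there. Let d ≥ 1, let (k₁,l₁),…,(k_μ,l_μ) be an enumeration without repetition of all pairs (k,l) ∈ ℕ² with k+l ≤ d (so μ = (d+1)(d+2)/2), and set g_i := f₁^{k_i}·f₂^{l_i}. Let 0 < δ < 1/2, let I ⊆ [0,1] be an interval of length at most δ, and let p₁,…,p_μ ∈ I. Then |det (g_i(p_j))_{1≤i,j≤μ}| ≤ μ! · (2μ+2)^μ · M^{dμ} · δ^{μ(μ−1)/2}. -/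
/-- Cauchy's estimate on an open disc of radius `1`, where the bound is only known inside. -/
theorem norm_taylorCoeff_le_of_forall_mem_ball {g : ℂ → ℂ} {c : ℂ} {B : ℝ}
    (hg : DifferentiableOn ℂ g (Metric.ball c 1)) (hB : ∀ z ∈ Metric.ball c 1, ‖g z‖ ≤ B) (n : ℕ) :
    ‖((n.factorial : ℂ)⁻¹ * iteratedDeriv n g c)‖ ≤ B := by
  have hfac : (0 : ℝ) < n.factorial := by exact_mod_cast n.factorial_pos
  have hcauchy : ∀ R : ℝ, 0 < R → R < 1 →
      R ^ n * ‖((n.factorial : ℂ)⁻¹ * iteratedDeriv n g c)‖ ≤ B := by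
    intro R hR hR1
    have hsub : Metric.closedBall c R ⊆ Metric.ball c 1 := Metric.closedBall_subset_ball hR1
    have hd : DiffContOnCl ℂ g (Metric.ball c R) :=
      DifferentiableOn.diffContOnCl (by
        rw [closure_ball c hR.ne']
        exact hg.mono hsub)
    have h := Complex.norm_iteratedDeriv_le_of_forall_mem_sphere_norm_le n hR hd
      (fun z hz => hB z (hsub (Metric.sphere_subset_closedBall hz)))
    rw [norm_mul, norm_inv, Complex.norm_natCast]
    rw [le_div_iff₀ (pow_pos hR n)] at h
    calc R ^ n * ((n.factorial : ℝ)⁻¹ * ‖iteratedDeriv n g c‖)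
        = (n.factorial : ℝ)⁻¹ * (‖iteratedDeriv n g c‖ * R ^ n) := by ring
      _ ≤ (n.factorial : ℝ)⁻¹ * (n.factorial * B) := by gcongr
      _ = B := by field_simp
  have hlim : Filter.Tendsto
      (fun R : ℝ => R ^ n * ‖((n.factorial : ℂ)⁻¹ * iteratedDeriv n g c)‖)
      (nhdsWithin 1 (Set.Iio 1)) (nhds (1 ^ n * ‖((n.factorial : ℂ)⁻¹ * iteratedDeriv n g c)‖)) :=
    (Continuous.tendsto (by fun_prop) 1).mono_left nhdsWithin_le_nhds
  rw [one_pow, one_mul] at hlim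
  refine le_of_tendsto hlim ?_
  filter_upwards [Ioo_mem_nhdsLT (zero_lt_one' ℝ)] with R hR using hcauchy R hR.1 hR.2

/-- Taylor expansion of a bounded holomorphic function on a disc of radius `1`, with bounds for
the coefficients and for the remainder on the disc of half the radius. -/
theorem exists_taylor_approx {g : ℂ → ℂ} {c : ℂ} {B : ℝ}
    (hg : DifferentiableOn ℂ g (Metric.ball c 1)) (hB : ∀ z ∈ Metric.ball c 1, ‖g z‖ ≤ B) (m : ℕ) :
    ∃ coeff : ℕ → ℂ, (∀ n, ‖coeff n‖ ≤ B) ∧ ∀ z, ‖z - c‖ ≤ 1 / 2 →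
      ‖g z - ∑ n ∈ Finset.range m, coeff n * (z - c) ^ n‖ ≤ 2 * B * ‖z - c‖ ^ m := by
  have hcoeff := norm_taylorCoeff_le_of_forall_mem_ball hg hB
  refine ⟨fun n => (n.factorial : ℂ)⁻¹ * iteratedDeriv n g c, hcoeff, fun z hz => ?_⟩
  have hB0 : 0 ≤ B := (norm_nonneg _).trans (hcoeff 0)
  have hzb : z ∈ Metric.ball c 1 := by
    rw [mem_ball_iff_norm]
    linarith
  have hsum : HasSum (fun n : ℕ => (n.factorial : ℂ)⁻¹ * iteratedDeriv n g c * (z - c) ^ n)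
      (g z) := by
    refine (Complex.hasSum_taylorSeries_on_ball hg hzb).congr_fun ?_
    intro n
    simp only [smul_eq_mul]
    ring
  have htail := (hasSum_nat_add_iff' m).2 hsum
  have hgeom := (hasSum_geometric_of_lt_one (norm_nonneg (z - c)) (by linarith)).mul_left
    (B * ‖z - c‖ ^ m)
  rw [← htail.tsum_eq]
  refine (tsum_of_norm_bounded hgeom fun n => ?_).trans ?_
  · rw [norm_mul, norm_pow, pow_add, mul_assoc, mul_comm (‖z - c‖ ^ m)]
    gcongr
    exact hcoeff _
  · have hinv : (1 - ‖z - c‖)⁻¹ ≤ 2 := by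
      rw [inv_le_comm₀ (by linarith) two_pos]
      linarith
    calc B * ‖z - c‖ ^ m * (1 - ‖z - c‖)⁻¹ ≤ B * ‖z - c‖ ^ m * 2 := by gcongr
      _ = 2 * B * ‖z - c‖ ^ m := by ring

/-- If `s` takes values at most `m` and every value less than `m` at most once, then the sum of
its `m + 1` values is at least `0 + 1 + ⋯ + m`. -/
theorem sum_range_le_sum_of_injective_below {m : ℕ} (s : Fin (m + 1) → Fin (m + 1))
    (hs : ∀ j j', s j = s j' → (s j : ℕ) < m → j = j') :
    ∑ n ∈ Finset.range (m + 1), n ≤ ∑ j, (s j : ℕ) := by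
  have hdefect : ∑ j, (m - (s j : ℕ)) ≤ ∑ n ∈ Finset.range (m + 1), (m - n) := by
    have hfilter : ∑ j, (m - (s j : ℕ)) =
        ∑ j ∈ Finset.univ.filter (fun j => (s j : ℕ) < m), (m - (s j : ℕ)) := by
      rw [Finset.sum_filter]
      refine Finset.sum_congr rfl fun j _ => ?_
      split_ifs <;> omega
    have hinj : Set.InjOn s (Finset.univ.filter (fun j => (s j : ℕ) < m) : Finset _) := by
      intro j hj j' _ h
      exact hs j j' h (by simpa using hj)
    rw [hfilter, ← Finset.sum_image (f := fun n : Fin (m + 1) => m - (n : ℕ)) hinj,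
      Finset.sum_range (fun n => m - n)]
    exact Finset.sum_le_sum_of_subset (Finset.subset_univ _)
  have hreflect : ∑ n ∈ Finset.range (m + 1), (m - n) = ∑ n ∈ Finset.range (m + 1), n := by
    simpa using Finset.sum_range_reflect (fun n => n) (m + 1)
  have htotal : ∑ j, (m - (s j : ℕ)) + ∑ j, (s j : ℕ) = (m + 1) * m := by
    rw [← Finset.sum_add_distrib]
    have : ∀ j, m - (s j : ℕ) + s j = m := fun j => by omega
    simp [this]
  have hgauss := Finset.sum_range_id_mul_two (m + 1)
  simp only [Nat.add_sub_cancel] at hgauss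
  omega

/-- The Leibniz bound for a determinant whose entries are bounded row by row. -/
theorem norm_det_le_factorial_mul_prod {ι : Type*} [Fintype ι] [DecidableEq ι]
    (A : Matrix ι ι ℂ) (r : ι → ℝ) (hA : ∀ i j, ‖A i j‖ ≤ r i) :
    ‖A.det‖ ≤ ((Fintype.card ι).factorial : ℝ) * ∏ i, r i := by
  rw [← Matrix.det_transpose, Matrix.det_apply']
  refine (norm_sum_le _ _).trans ?_
  have hterm : ∀ σ ∈ (Finset.univ : Finset (Equiv.Perm ι)),
      ‖((Equiv.Perm.sign σ : ℤ) : ℂ) * ∏ i, A.transpose (σ i) i‖ ≤ ∏ i, r i := by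
    intro σ _
    have hsign : ‖((Equiv.Perm.sign σ : ℤ) : ℂ)‖ = 1 := by
      rcases Int.units_eq_one_or (Equiv.Perm.sign σ) with h | h <;> simp [h]
    rw [norm_mul, hsign, one_mul, norm_prod]
    exact Finset.prod_le_prod (fun _ _ => norm_nonneg _) fun i _ => hA i (σ i)
  refine (Finset.sum_le_card_nsmul _ _ _ hterm).trans ?_
  rw [Finset.card_univ, Fintype.card_perm, nsmul_eq_mul]

/-- A determinant whose rows are, up to an error of order `δ ^ m`, polynomials of degree less than
`m` in quantities of size at most `δ` is small. -/
theorem norm_det_le_of_polynomial_approx {m : ℕ} (A : Matrix (Fin (m + 1)) (Fin (m + 1)) ℂ)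
    (coeff : Fin (m + 1) → ℕ → ℂ) (w : Fin (m + 1) → ℂ) {B δ : ℝ} (hδ0 : 0 ≤ δ) (hδ1 : δ ≤ 1)
    (hw : ∀ j, ‖w j‖ ≤ δ) (hcoeff : ∀ i n, ‖coeff i n‖ ≤ B)
    (hrem : ∀ j i, ‖A j i - ∑ n ∈ Finset.range m, coeff i n * w j ^ n‖ ≤ 2 * B * δ ^ m) :
    ‖A.det‖ ≤ ((m + 1).factorial : ℝ) * (m + 1 : ℝ) ^ (m + 1) * (2 * B) ^ (m + 1) *
      δ ^ (∑ n ∈ Finset.range (m + 1), n) := by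
  have hB0 : 0 ≤ B := (norm_nonneg _).trans (hcoeff 0 0)
  let rem : Fin (m + 1) → Fin (m + 1) → ℂ := fun j i =>
    A j i - ∑ n ∈ Finset.range m, coeff i n * w j ^ n
  let scale : Fin (m + 1) → Fin (m + 1) → ℂ := fun j n => if (n : ℕ) < m then w j ^ (n : ℕ) else 1
  let vec : Fin (m + 1) → Fin (m + 1) → Fin (m + 1) → ℂ := fun j n i =>
    if (n : ℕ) < m then coeff i n else rem j i
  have hrow : A = fun j => ∑ n : Fin (m + 1), fun i => scale j n * vec j n i := by
    funext j i
    rw [Finset.sum_apply, Fin.sum_univ_castSucc]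
    simp only [scale, vec, rem, Fin.val_castSucc, Fin.is_lt, if_true, Fin.val_last, lt_irrefl,
      if_false, one_mul]
    rw [Finset.sum_range]
    simp [mul_comm]
  have hexpand : A.det = ∑ s : Fin (m + 1) → Fin (m + 1),
      Matrix.det (Matrix.of fun j i => scale j (s j) * vec j (s j) i) := by
    conv_lhs => rw [hrow]
    exact (Matrix.detRowAlternating (R := ℂ) (n := Fin (m + 1))).toMultilinearMap.map_sum
      (fun j n i => scale j n * vec j n i)
  have hentry : ∀ j n i, ‖scale j n * vec j n i‖ ≤ 2 * B * δ ^ (n : ℕ) := by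
    intro j n i
    by_cases hn : (n : ℕ) < m
    · simp only [scale, vec, hn, if_true, norm_mul, norm_pow]
      calc ‖w j‖ ^ (n : ℕ) * ‖coeff i n‖ ≤ δ ^ (n : ℕ) * B := by
            gcongr
            · exact hw j
            · exact hcoeff i n
        _ ≤ 2 * B * δ ^ (n : ℕ) := by nlinarith [mul_nonneg hB0 (pow_nonneg hδ0 (n : ℕ))]
    · have hnm : (n : ℕ) = m := by omega
      simpa [scale, vec, rem, hnm] using hrem j i
  have hterm : ∀ s ∈ (Finset.univ : Finset (Fin (m + 1) → Fin (m + 1))),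
      ‖Matrix.det (Matrix.of fun j i => scale j (s j) * vec j (s j) i)‖ ≤
        ((m + 1).factorial : ℝ) * ((2 * B) ^ (m + 1) * δ ^ (∑ n ∈ Finset.range (m + 1), n)) := by
    intro s _
    by_cases hs : ∀ j j', s j = s j' → (s j : ℕ) < m → j = j'
    · refine (norm_det_le_factorial_mul_prod _ (fun j => 2 * B * δ ^ (s j : ℕ))
        fun j i => hentry j (s j) i).trans ?_
      rw [Fintype.card_fin, Finset.prod_mul_distrib, Finset.prod_const, Finset.card_univ,
        Fintype.card_fin, Finset.prod_pow_eq_pow_sum]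
      gcongr ?_ * (?_ * ?_)
      exact pow_le_pow_of_le_one hδ0 hδ1 (sum_range_le_sum_of_injective_below s hs)
    · push Not at hs
      obtain ⟨j, j', hjj', hlt, hne⟩ := hs
      have hzero : Matrix.det (Matrix.of fun j i => vec j (s j) i) = 0 := by
        refine Matrix.det_zero_of_row_eq hne ?_
        funext i
        simp [vec, ← hjj', hlt]
      have hfactor := Matrix.det_mul_column (fun j => scale j (s j))
        (Matrix.of fun j i => vec j (s j) i)
      simp only [Matrix.of_apply, hzero, mul_zero] at hfactor
      rw [hfactor, norm_zero]
      positivity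
  rw [hexpand]
  refine ((norm_sum_le _ _).trans (Finset.sum_le_card_nsmul _ _ _ hterm)).trans (le_of_eq ?_)
  simp only [Finset.card_univ, Fintype.card_fun, Fintype.card_fin, nsmul_eq_mul]
  push_cast
  ring

theorem bombieri_pila_determinant_upper_bound
    (M : ℝ) (hM : 1 ≤ M) (f₁ f₂ : ℂ → ℂ)
    (hf₁ : DifferentiableOn ℂ f₁ (Metric.ball (0 : ℂ) 2))
    (hf₂ : DifferentiableOn ℂ f₂ (Metric.ball (0 : ℂ) 2))
    (hb₁ : ∀ z ∈ Metric.ball (0 : ℂ) 2, ‖f₁ z‖ ≤ M)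
    (hb₂ : ∀ z ∈ Metric.ball (0 : ℂ) 2, ‖f₂ z‖ ≤ M)
    (d : ℕ) (hd : 1 ≤ d) (μ : ℕ)
    (kl : Fin μ → ℕ × ℕ) (hinj : Function.Injective kl)
    (hrange : ∀ q : ℕ × ℕ, q.1 + q.2 ≤ d ↔ ∃ i, kl i = q)
    (δ : ℝ) (hδ0 : 0 < δ) (hδ : δ < 1 / 2)
    (a b : ℝ) (ha : 0 ≤ a) (hb : b ≤ 1) (hlen : b - a ≤ δ)
    (p : Fin μ → ℝ) (hp : ∀ j, p j ∈ Set.Icc a b) :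
    ‖Matrix.det (Matrix.of fun i j =>
        f₁ ((p j : ℂ)) ^ (kl i).1 * f₂ ((p j : ℂ)) ^ (kl i).2)‖ ≤
      (Nat.factorial μ : ℝ) * (2 * (μ : ℝ) + 2) ^ μ * M ^ (d * μ) *
        δ ^ (μ * (μ - 1) / 2) := by
  obtain ⟨i₀, -⟩ := (hrange (0, 0)).1 (Nat.zero_le d)
  obtain ⟨m, rfl⟩ : ∃ m, μ = m + 1 := ⟨μ - 1, by have := i₀.isLt; omega⟩
  have ha1 : a ≤ 1 := ((hp i₀).1.trans (hp i₀).2).trans hb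
  have hsub : Metric.ball (a : ℂ) 1 ⊆ Metric.ball (0 : ℂ) 2 := by
    refine Metric.ball_subset_ball' ?_
    rw [dist_zero_right, Complex.norm_real, Real.norm_of_nonneg ha]
    linarith
  have hbound : ∀ i, ∀ z ∈ Metric.ball (a : ℂ) 1,
      ‖f₁ z ^ (kl i).1 * f₂ z ^ (kl i).2‖ ≤ M ^ d := by
    intro i z hz
    rw [norm_mul, norm_pow, norm_pow]
    calc ‖f₁ z‖ ^ (kl i).1 * ‖f₂ z‖ ^ (kl i).2 ≤ M ^ (kl i).1 * M ^ (kl i).2 := by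
          gcongr
          · exact hb₁ z (hsub hz)
          · exact hb₂ z (hsub hz)
      _ = M ^ ((kl i).1 + (kl i).2) := (pow_add M _ _).symm
      _ ≤ M ^ d := pow_le_pow_right₀ hM ((hrange _).2 ⟨i, rfl⟩)
  choose coeff hcoeff hrem using fun i => exists_taylor_approx
    (((hf₁.mono hsub).pow (kl i).1).mul ((hf₂.mono hsub).pow (kl i).2)) (hbound i) m
  have hw : ∀ j, ‖(p j : ℂ) - a‖ ≤ δ := by
    intro j
    rw [← Complex.ofReal_sub, Complex.norm_real, Real.norm_of_nonneg (by linarith [(hp j).1])]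
    linarith [(hp j).2]
  have hdet := norm_det_le_of_polynomial_approx
    (Matrix.of fun j i => f₁ ((p j : ℂ)) ^ (kl i).1 * f₂ ((p j : ℂ)) ^ (kl i).2)
    coeff (fun j => (p j : ℂ) - a) hδ0.le (by linarith) hw hcoeff (fun j i =>
      (hrem i (p j) ((hw j).trans hδ.le)).trans (by gcongr; exact hw j))
  rw [← Matrix.det_transpose]
  refine hdet.trans ?_
  rw [Finset.sum_range_id, mul_pow, ← pow_mul]
  have hconst : (m + 1 : ℝ) ^ (m + 1) * 2 ^ (m + 1) ≤ (2 * ((m + 1 : ℕ) : ℝ) + 2) ^ (m + 1) := by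
    rw [← mul_pow]
    push_cast
    gcongr
    linarith
  calc ((m + 1).factorial : ℝ) * (m + 1 : ℝ) ^ (m + 1) * (2 ^ (m + 1) * M ^ (d * (m + 1))) *
        δ ^ ((m + 1) * (m + 1 - 1) / 2)
      = ((m + 1).factorial : ℝ) * ((m + 1 : ℝ) ^ (m + 1) * 2 ^ (m + 1)) * M ^ (d * (m + 1)) *
        δ ^ ((m + 1) * (m + 1 - 1) / 2) := by ring
    _ ≤ _ := by gcongr
end

section
/- Let n ≥ 1 and m ≥ 1, let Δ ⊆ Δ' be open polydiscs centered at 0 in ℂⁿ, let ℳ ⊆ ℕⁿ be a co-ideal, let K ≥ 1, and suppose X ⊆ ℂⁿ admits decomposition with respect to (ℳ, Δ, Δ') with norm K. Let e ≥ 1 satisfy #{α ∈ ℳ : |α| = k} ≤ e·L(m,k) for all k ∈ ℕ. Let 0 < δ < 1 and let D be an open polydisc centered at 0 whose rescaling D^δ := {δ^{−1}·z : z ∈ D} is contained in Δ. Let F be holomorphic on a neighborhood of the closure of Δ', set M := sup_{Δ'} |F|, and let coefficients c_α (α ∈ ℳ) and a holomorphic function Q witness the decomposition of F (i.e., satisfy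 all the conditions in the definition of decomposition). Then: (a) sup_{z∈D} |c_α z^α| ≤ K·M·δ^{|α|} for every α ∈ ℳ; and (b) for every k ∈ ℕ, sup_{z∈D} Σ_{α∈ℳ, |α|≥k} |c_α z^α| ≤ (K·e·L(m,k)/(1−δ)^m)·M·δ^k. -/
open scoped BigOperators

/-- The open polydisc in `ℂⁿ` centered at `0` of polyradius `r`. -/
def polydisc0 {n : ℕ} (r : Fin n → ℝ) : Set (Fin n → ℂ) :=
  {z | ∀ i, ‖z i‖ < r i}

/-- A co-ideal of multi-indices: downward closed under the componentwise order. -/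
def IsCoideal {n : ℕ} (ℳ : Set (Fin n → ℕ)) : Prop :=
  ∀ α ∈ ℳ, ∀ β : Fin n → ℕ, (∀ i, β i ≤ α i) → β ∈ ℳ

/-- The monomial `z ^ α`. -/
def mon {n : ℕ} (α : Fin n → ℕ) (z : Fin n → ℂ) : ℂ := ∏ i, z i ^ α i

/-- `L n k`: the number of monomials of degree exactly `k` in `n` variables. -/
def L (n k : ℕ) : ℕ := (n + k - 1).choose (n - 1)

/-- The data `(c, Q)` witnesses the decomposition of `F` with respect to
`(ℳ, Δ, Δ')` with norm `K`: `Q` is holomorphic on `Δ`, the series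
`∑_{α ∈ ℳ} c_α z^α` converges on `Δ`, `F = ∑_{α ∈ ℳ} c_α z^α + Q` on `Δ`,
`Q` vanishes identically on `X ∩ Δ`, and
`sup_Δ ‖c_α z^α‖ ≤ K ⬝ sup_{Δ'} ‖F‖` for every `α ∈ ℳ`. -/
def IsDecompWitness {n : ℕ} (X : Set (Fin n → ℂ)) (ℳ : Set (Fin n → ℕ))
    (Δ Δ' : Set (Fin n → ℂ)) (K : ℝ) (F : (Fin n → ℂ) → ℂ)
    (c : (Fin n → ℕ) → ℂ) (Q : (Fin n → ℂ) → ℂ) : Prop :=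
  DifferentiableOn ℂ Q Δ ∧
  (∀ z ∈ Δ, Summable fun α : ℳ => c α.1 * mon α.1 z) ∧
  (∀ z ∈ Δ, F z = (∑' α : ℳ, c α.1 * mon α.1 z) + Q z) ∧
  (∀ z ∈ X ∩ Δ, Q z = 0) ∧
  (∀ α ∈ ℳ, ∀ z ∈ Δ, ‖c α * mon α z‖ ≤ K * sSup ((fun x => ‖F x‖) '' Δ'))

/-- `X` admits decomposition with respect to `(ℳ, Δ, Δ')` with norm `K`:
every `F` holomorphic on a neighborhood of the closure of `Δ'` admits a
decomposition witness. -/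
def AdmitsDecomposition {n : ℕ} (X : Set (Fin n → ℂ)) (ℳ : Set (Fin n → ℕ))
    (Δ Δ' : Set (Fin n → ℂ)) (K : ℝ) : Prop :=
  ∀ F : (Fin n → ℂ) → ℂ,
    (∃ V : Set (Fin n → ℂ), IsOpen V ∧ closure Δ' ⊆ V ∧ DifferentiableOn ℂ F V) →
    ∃ (c : (Fin n → ℕ) → ℂ) (Q : (Fin n → ℂ) → ℂ), IsDecompWitness X ℳ Δ Δ' K F c Q

theorem Nat.choose_add_add_le_mul (d k i : ℕ) :
    (d + (k + i)).choose d ≤ (d + k).choose d * (d + i).choose d := by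
  induction i with
  | zero => simp
  | succ i ih =>
    have hstep (j : ℕ) :
        (d + (j + 1)).choose d * (j + 1) = (d + j).choose d * (d + j + 1) := by
      have h := Nat.add_one_mul_choose_eq (d + j) j
      rw [add_assoc d j 1, ← Nat.choose_symm_add, ← Nat.choose_symm_add] at h
      rw [← h, mul_comm, add_assoc]
    refine Nat.le_of_mul_le_mul_right (c := (k + i + 1) * (i + 1)) ?_ (by positivity)
    calc (d + (k + (i + 1))).choose d * ((k + i + 1) * (i + 1))
        = (d + (k + i)).choose d * ((d + (k + i) + 1) * (i + 1)) := by
          rw [← mul_assoc, ← add_assoc k, hstep, mul_assoc]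
      _ ≤ ((d + k).choose d * (d + i).choose d) * ((k + i + 1) * (d + i + 1)) :=
          Nat.mul_le_mul ih (by nlinarith [Nat.zero_le (d * k)])
      _ = (d + k).choose d * (k + i + 1) * ((d + i).choose d * (d + i + 1)) := by ring
      _ = (d + k).choose d * (d + (i + 1)).choose d * ((k + i + 1) * (i + 1)) := by
          rw [← hstep]; ring

/-- The number of monomials is submultiplicative in the degree. -/
theorem L_add_le_mul {m : ℕ} (hm : 1 ≤ m) (k i : ℕ) : L m (k + i) ≤ L m k * L m i := by
  obtain ⟨d, rfl⟩ := Nat.exists_eq_add_of_le' hm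
  have h (j : ℕ) : L (d + 1) j = (d + j).choose d := by
    rw [L, show d + 1 + j - 1 = d + j by omega, Nat.add_sub_cancel]
  simpa only [h] using Nat.choose_add_add_le_mul d k i

theorem hasSum_L_mul_geometric {m : ℕ} (hm : 1 ≤ m) {δ : ℝ} (hδ0 : 0 ≤ δ) (hδ1 : δ < 1) :
    HasSum (fun i => (L m i : ℝ) * δ ^ i) (1 / (1 - δ) ^ m) := by
  obtain ⟨d, rfl⟩ := Nat.exists_eq_add_of_le' hm
  have h (i : ℕ) : L (d + 1) i = (i + d).choose d := by
    rw [L, show d + 1 + i - 1 = i + d by omega, Nat.add_sub_cancel]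
  simpa only [h] using hasSum_choose_mul_geometric_of_norm_lt_one d
    (show ‖δ‖ < 1 by rwa [Real.norm_of_nonneg hδ0])

theorem mon_smul {n : ℕ} (a : ℂ) (α : Fin n → ℕ) (z : Fin n → ℂ) :
    mon α (a • z) = a ^ (∑ i, α i) * mon α z := by
  simp [mon, mul_pow, Finset.prod_mul_distrib, Finset.prod_pow_eq_pow_sum]

theorem finite_setOf_sum_eq {n : ℕ} (j : ℕ) : {α : Fin n → ℕ | ∑ i, α i = j}.Finite := by
  refine (Set.finite_Iic fun _ : Fin n => j).subset fun α hα i => ?_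
  rw [← show ∑ i, α i = j from hα]
  exact Finset.single_le_sum (fun _ _ => Nat.zero_le _) (Finset.mem_univ i)

/-- Finite sums of `δ ^ |α|` over multi-indices of degree at least `k` in a set with at most
`e * L m j` elements in each degree `j`. -/
theorem sum_pow_degree_le {n m : ℕ} (hm : 1 ≤ m) {ℳ : Set (Fin n → ℕ)} {e : ℕ}
    (hcount : ∀ k : ℕ, ({α ∈ ℳ | (∑ i, α i) = k}).ncard ≤ e * L m k)
    {δ : ℝ} (hδ0 : 0 ≤ δ) (hδ1 : δ < 1) (k : ℕ)
    (s : Finset {a : Fin n → ℕ // a ∈ ℳ ∧ k ≤ ∑ i, a i}) :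
    ∑ α ∈ s, δ ^ (∑ i, α.1 i) ≤ (e : ℝ) * L m k / (1 - δ) ^ m * δ ^ k := by
  classical
  set g : {a : Fin n → ℕ // a ∈ ℳ ∧ k ≤ ∑ i, a i} → ℕ := fun α => ∑ i, α.1 i - k
  have hdeg (α : {a : Fin n → ℕ // a ∈ ℳ ∧ k ≤ ∑ i, a i}) : ∑ i, α.1 i = k + g α :=
    (Nat.add_sub_of_le α.2.2).symm
  have hcard (j : ℕ) : (s.filter fun α => g α = j).card ≤ e * L m (k + j) := by
    refine le_trans ?_ (hcount (k + j))
    rw [← Finset.card_map (Function.Embedding.subtype _), ← Set.ncard_coe_finset]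
    refine Set.ncard_le_ncard ?_ ((finite_setOf_sum_eq (k + j)).subset fun α hα => hα.2)
    intro a ha
    obtain ⟨α, hα, rfl⟩ := Finset.mem_map.1 (Finset.mem_coe.1 ha)
    refine ⟨α.2.1, ?_⟩
    rw [← (Finset.mem_filter.1 hα).2]
    exact hdeg α
  calc ∑ α ∈ s, δ ^ (∑ i, α.1 i)
      = ∑ j ∈ s.image g, ∑ α ∈ s with g α = j, δ ^ (∑ i, α.1 i) :=
        (Finset.sum_fiberwise_of_maps_to (fun α hα => Finset.mem_image_of_mem g hα) _).symm
    _ ≤ ∑ j ∈ s.image g, (e : ℝ) * L m k * δ ^ k * (L m j * δ ^ j) := by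
        refine Finset.sum_le_sum fun j _ => ?_
        have hbound : ((s.filter fun α => g α = j).card : ℝ) ≤ e * (L m k * L m j) := by
          exact_mod_cast (hcard j).trans (Nat.mul_le_mul_left e (L_add_le_mul hm k j))
        rw [Finset.sum_congr rfl fun α hα => by
          rw [hdeg α, (Finset.mem_filter.1 hα).2], Finset.sum_const, nsmul_eq_mul]
        calc _ ≤ (e * (L m k * L m j) : ℝ) * δ ^ (k + j) := by gcongr
          _ = _ := by ring
    _ = (e : ℝ) * L m k * δ ^ k * ∑ j ∈ s.image g, L m j * δ ^ j := by rw [Finset.mul_sum]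
    _ ≤ (e : ℝ) * L m k * δ ^ k * (1 / (1 - δ) ^ m) := by
        gcongr
        exact sum_le_hasSum _ (fun _ _ => by positivity) (hasSum_L_mul_geometric hm hδ0 hδ1)
    _ = _ := by ring

theorem norm_estimates_for_decomposition {n m : ℕ} (hn : 1 ≤ n) (hm : 1 ≤ m)
    (rΔ rΔ' : Fin n → ℝ) (hrΔ : ∀ i, 0 < rΔ i) (hrΔ' : ∀ i, 0 < rΔ' i)
    (hΔΔ' : polydisc0 rΔ ⊆ polydisc0 rΔ')
    (ℳ : Set (Fin n → ℕ)) (hℳ : IsCoideal ℳ)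
    (K : ℝ) (hK : 1 ≤ K) (X : Set (Fin n → ℂ))
    (hX : AdmitsDecomposition X ℳ (polydisc0 rΔ) (polydisc0 rΔ') K)
    (e : ℕ) (he : 1 ≤ e)
    (hcount : ∀ k : ℕ, ({α ∈ ℳ | (∑ i, α i) = k}).ncard ≤ e * L m k)
    (δ : ℝ) (hδ0 : 0 < δ) (hδ1 : δ < 1)
    (rD : Fin n → ℝ) (hrD : ∀ i, 0 < rD i)
    (hD : (fun z => (δ⁻¹ : ℂ) • z) '' polydisc0 rD ⊆ polydisc0 rΔ)
    (F : (Fin n → ℂ) → ℂ)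
    (hF : ∃ V : Set (Fin n → ℂ), IsOpen V ∧ closure (polydisc0 rΔ') ⊆ V ∧
      DifferentiableOn ℂ F V)
    (M : ℝ) (hM : M = sSup ((fun x => ‖F x‖) '' polydisc0 rΔ'))
    (c : (Fin n → ℕ) → ℂ) (Q : (Fin n → ℂ) → ℂ)
    (hw : IsDecompWitness X ℳ (polydisc0 rΔ) (polydisc0 rΔ') K F c Q) :
    (∀ α ∈ ℳ, ∀ z ∈ polydisc0 rD, ‖c α * mon α z‖ ≤ K * M * δ ^ (∑ i, α i)) ∧
    (∀ k : ℕ, ∀ z ∈ polydisc0 rD,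
      (Summable fun α : {a : Fin n → ℕ // a ∈ ℳ ∧ k ≤ ∑ i, a i} =>
        ‖c α.1 * mon α.1 z‖) ∧
      (∑' α : {a : Fin n → ℕ // a ∈ ℳ ∧ k ≤ ∑ i, a i}, ‖c α.1 * mon α.1 z‖) ≤
        K * (e : ℝ) * (L m k : ℝ) / (1 - δ) ^ m * M * δ ^ k) := by
  have hM0 : 0 ≤ M := hM ▸ Real.sSup_nonneg (by rintro _ ⟨x, -, rfl⟩; exact norm_nonneg _)
  have hKM : 0 ≤ K * M := mul_nonneg (zero_le_one.trans hK) hM0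
  have hterm : ∀ α ∈ ℳ, ∀ z ∈ polydisc0 rD, ‖c α * mon α z‖ ≤ K * M * δ ^ (∑ i, α i) := by
    intro α hα z hz
    have hδ : (δ : ℂ) ≠ 0 := by exact_mod_cast hδ0.ne'
    have hbound := hw.2.2.2.2 α hα _ (hD ⟨z, hz, rfl⟩)
    rw [← hM] at hbound
    have hz' : mon α z = (δ : ℂ) ^ (∑ i, α i) * mon α ((δ⁻¹ : ℂ) • z) := by
      rw [← mon_smul, smul_inv_smul₀ hδ]
    rw [hz', mul_left_comm, norm_mul, norm_pow, Complex.norm_real, Real.norm_of_nonneg hδ0.le,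
      mul_comm]
    gcongr
  refine ⟨hterm, fun k z hz => ?_⟩
  have hsum (s : Finset {a : Fin n → ℕ // a ∈ ℳ ∧ k ≤ ∑ i, a i}) :
      ∑ α ∈ s, ‖c α.1 * mon α.1 z‖ ≤
        K * (e : ℝ) * (L m k : ℝ) / (1 - δ) ^ m * M * δ ^ k :=
    calc ∑ α ∈ s, ‖c α.1 * mon α.1 z‖
        ≤ ∑ α ∈ s, K * M * δ ^ (∑ i, α.1 i) :=
          Finset.sum_le_sum fun α _ => hterm α.1 α.2.1 z hz
      _ = K * M * ∑ α ∈ s, δ ^ (∑ i, α.1 i) := by rw [Finset.mul_sum]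
      _ ≤ K * M * ((e : ℝ) * L m k / (1 - δ) ^ m * δ ^ k) := by
          gcongr
          exact sum_pow_degree_le hm hcount hδ0.le hδ1 k s
      _ = _ := by ring
  have hsummable := summable_of_sum_le (fun _ => norm_nonneg _) hsum
  exact ⟨hsummable, hsummable.tsum_le_of_sum_le hsum⟩
end
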